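/- arXiv:1112.3719 — 3 statements merged into one kernel-verified Lean document; each statement's English description precedes it below -/
import Mathlib

section
/- The number of pairings of 2k vertices on a circle in which exactly 4 vertices are involved in crossings equals binomial(2k, k-2). -/
open Finset

/-- A pairing (perfect matching) of `n` vertices on a circle, encoded as a
fixed-point-free involution. -/
def IsPairing {n : ℕ} (f : Fin n → Fin n) : Prop :=
  (∀ i, f (f i) = i) ∧ ∀ i, f i ≠ i

/-- `x` lies strictly between `a` and `b` going clockwise around the circle. -/
def CircBtw {n : ℕ} (a b x : Fin n) : Prop :=
  0 < (x - a).val ∧ (x - a).val < (b - a).val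

/-- The chord through `i` and the chord through `j` cross: exactly one of
`j`, `f j` lies strictly between `i` and `f i` clockwise. -/
def ChordsCross {n : ℕ} (f : Fin n → Fin n) (i j : Fin n) : Prop :=
  Xor' (CircBtw i (f i) j) (CircBtw i (f i) (f j))

/-- Vertex `i` is involved in a crossing: its chord crosses some other chord. -/
def CrossVert {n : ℕ} (f : Fin n → Fin n) (i : Fin n) : Prop :=
  ∃ j, j ≠ i ∧ j ≠ f i ∧ ChordsCross f i j

open Classical in
/-- The set of all pairings of `2k` vertices on a circle. -/
noncomputable def pairings (k : ℕ) : Finset (Fin (2*k) → Fin (2*k)) :=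
  Finset.univ.filter IsPairing

open Classical in
/-- The number of vertices involved in at least one crossing. -/
noncomputable def crossCount (k : ℕ) (f : Fin (2*k) → Fin (2*k)) : ℕ :=
  (Finset.univ.filter (fun i => CrossVert f i)).card

open Classical in
/-- `Cr k m`: the number of pairings of `2k` vertices with exactly `m`
vertices involved in a crossing. -/
noncomputable def Cr (k m : ℕ) : ℕ :=
  ((pairings k).filter (fun f => crossCount k f = m)).card

/-- `f` restricts to a pairing of `V` whose only crossing is that of `{a,c}` and `{b,d}`. -/
structure Good {α : Type*} [LinearOrder α] (V : Finset α) (f : α → α) (a b c d : α) : Prop where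
  hab : a < b
  hbc : b < c
  hcd : c < d
  ha : a ∈ V
  hb : b ∈ V
  hc : c ∈ V
  hd : d ∈ V
  fa : f a = c
  fb : f b = d
  fc : f c = a
  fd : f d = b
  maps : ∀ i ∈ V, f i ∈ V
  inv : ∀ i ∈ V, f (f i) = i
  ne : ∀ i ∈ V, f i ≠ i
  nc : ∀ i ∈ V, i ≠ a → i ≠ b → i ≠ c → i ≠ d → ∀ j ∈ V, i < j → j < f i → i < f j ∧ f j < f i

/-- `i` is the (cyclic) opening vertex of a non-crossing chord. -/
def Op {α : Type*} [LinearOrder α] (f : α → α) (a b c d i : α) : Prop :=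
  i ≠ a ∧ i ≠ b ∧ i ≠ c ∧ i ≠ d ∧ ((i < f i ∧ ¬ (i < a ∧ a < f i)) ∨ (f i < i ∧ f i < a ∧ a < i))

/-- `i, j` are cyclically adjacent in `V`. -/
def Adj {α : Type*} [LinearOrder α] (V : Finset α) (i j : α) : Prop :=
  (i < j ∧ ∀ x ∈ V, ¬ (i < x ∧ x < j)) ∨ (j < i ∧ ∀ x ∈ V, j ≤ x ∧ x ≤ i)

section
variable {α : Type*} [LinearOrder α]

lemma exists_adj (V S : Finset α) (hS : S ⊆ V) (h1 : S.Nonempty) (h2 : (V \ S).Nonempty) :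
    ∃ i ∈ S, ∃ j ∈ V, j ∉ S ∧ Adj V i j := by
  by_cases h : ∃ i ∈ S, ∃ j ∈ V \ S, i < j
  · obtain ⟨i0, hi0, j0, hj0, hij⟩ := h
    obtain ⟨j, hj, hjm⟩ := ((V \ S).filter (i0 < ·)).exists_min_image id ⟨j0, by simp_all⟩
    obtain ⟨i, hi, him⟩ := (S.filter (· < j)).exists_max_image id ⟨i0, by simp_all⟩
    simp only [mem_filter, mem_sdiff, id] at *
    have := him i0 ⟨hi0, hj.2⟩
    refine ⟨i, hi.1, j, hj.1.1, hj.1.2, Or.inl ⟨hi.2, fun x hx hh => ?_⟩⟩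
    by_cases hxS : x ∈ S
    · exact absurd (him x ⟨hxS, hh.2⟩) (not_le.2 hh.1)
    · exact absurd (hjm x ⟨⟨hx, hxS⟩, lt_of_le_of_lt this hh.1⟩) (not_le.2 hh.2)
  · push Not at h
    obtain ⟨i, hi, him⟩ := S.exists_max_image id h1
    obtain ⟨j, hj, hjm⟩ := (V \ S).exists_min_image id h2
    simp only [mem_sdiff, id] at *
    have hji : j < i := lt_of_le_of_ne (h i hi j hj) (by rintro rfl; exact hj.2 hi)
    refine ⟨i, hi, j, hj.1, hj.2, Or.inr ⟨hji, fun x hx => ?_⟩⟩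
    by_cases hxS : x ∈ S
    · exact ⟨h x hxS j hj, him x hxS⟩
    · exact ⟨hjm x ⟨hx, hxS⟩, h i hi x ⟨hx, hxS⟩⟩

lemma four_sorted (V : Finset α) (h : V.card = 4) :
    ∃ a b c d, a < b ∧ b < c ∧ c < d ∧ ∀ x, x ∈ V ↔ x = a ∨ x = b ∨ x = c ∨ x = d := by
  let e := V.orderEmbOfFin h
  refine ⟨e 0, e 1, e 2, e 3, by simp, by simp, by simp, fun x => ?_⟩
  have : x ∈ Set.range e ↔ x ∈ V := by rw [Finset.range_orderEmbOfFin]; simp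
  rw [← this]
  simp [Fin.exists_fin_succ, eq_comm]

lemma sorted_unique {a b c d a' b' c' d' : α} (h1 : a < b) (h2 : b < c) (h3 : c < d)
    (h1' : a' < b') (h2' : b' < c') (h3' : c' < d')
    (h : ∀ x, (x = a ∨ x = b ∨ x = c ∨ x = d) ↔ (x = a' ∨ x = b' ∨ x = c' ∨ x = d')) :
    a = a' ∧ b = b' ∧ c = c' ∧ d = d' := by
  have := (h a).1; have := (h b).1; have := (h c).1; have := (h d).1
  have := (h a').2; have := (h b').2; have := (h c').2; have := (h d').2
  clear h
  grind

variable {V : Finset α} {f g : α → α} {a b c d : α}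

/-- images of non-crossing-block points are not in the block -/
lemma Good.notC (G : Good V f a b c d) {i : α} (hi : i ∈ V)
    (h1 : i ≠ a) (h2 : i ≠ b) (h3 : i ≠ c) (h4 : i ≠ d) :
    f i ≠ a ∧ f i ≠ b ∧ f i ≠ c ∧ f i ≠ d := by
  have := G.inv i hi
  have := G.fa; have := G.fb; have := G.fc; have := G.fd
  grind

/-- For a noncrossing chord the block is inside or outside. -/
lemma Good.block (G : Good V f a b c d) {i : α} (hi : i ∈ V)
    (h1 : i ≠ a) (h2 : i ≠ b) (h3 : i ≠ c) (h4 : i ≠ d) (x : α) (hx : x = b ∨ x = c ∨ x = d) :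
    (i < x ∧ x < f i) ↔ (i < a ∧ a < f i) := by
  have := G.nc i hi h1 h2 h3 h4
  have ia := this a G.ha
  have ib := this b G.hb
  have ic := this c G.hc
  have id := this d G.hd
  have := G.fa; have := G.fb; have := G.fc; have := G.fd
  have := G.hab; have := G.hbc; have := G.hcd
  have := G.notC hi h1 h2 h3 h4
  grind

lemma Good.op_swap (G : Good V f a b c d) {i : α} (hi : i ∈ V)
    (h1 : i ≠ a) (h2 : i ≠ b) (h3 : i ≠ c) (h4 : i ≠ d) :
    Op f a b c d (f i) ↔ ¬ Op f a b c d i := by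
  have := G.notC hi h1 h2 h3 h4
  have := G.inv i hi
  have := G.ne i hi
  unfold Op
  grind

lemma Good.adj_eq (G : Good V f a b c d) {i j : α} (hi : i ∈ V) (hj : j ∈ V)
    (hA : Adj V i j) (oi : Op f a b c d i) (oj : ¬ Op f a b c d j) : f i = j := by
  by_contra hne
  have ne1 := G.ne i hi
  have inv1 := G.inv i hi
  have inv2 := G.inv j hj
  have mi := G.maps i hi
  have mj := G.maps j hj
  have nC := G.notC hi oi.1 oi.2.1 oi.2.2.1 oi.2.2.2.1
  have B1 := G.block hi oi.1 oi.2.1 oi.2.2.1 oi.2.2.2.1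
  have B2 := G.block mi nC.1 nC.2.1 nC.2.2.1 nC.2.2.2
  have N1 := G.nc i hi oi.1 oi.2.1 oi.2.2.1 oi.2.2.2.1
  have N2 := G.nc (f i) mi nC.1 nC.2.1 nC.2.2.1 nC.2.2.2
  rw [inv1] at B2 N2
  have jb1 := B1 b (by simp); have jc1 := B1 c (by simp); have jd1 := B1 d (by simp)
  have jb2 := B2 b (by simp); have jc2 := B2 c (by simp); have jd2 := B2 d (by simp)
  have n1 := N1 j hj; have n2 := N2 j hj
  have n1' := N1 (f j) mj; have n2' := N2 (f j) mj
  rw [inv2] at n1' n2'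
  have nej := G.ne j hj
  have := G.hab; have := G.hbc; have := G.hcd
  have mA := G.ha; have mB := G.hb; have mC := G.hc; have mD := G.hd
  clear B1 B2 N1 N2
  unfold Adj at hA
  rcases hA with ⟨hij, hA⟩ | ⟨hij, hA⟩
  · have A1 := hA _ mj; have A2 := hA _ mi
    have A3 := hA _ mA
    have A4 := hA _ mB
    have A5 := hA _ mC
    have A6 := hA _ mD
    clear hA
    unfold Op at *
    grind (splits := 30)
  · have A1 := hA _ mj; have A2 := hA _ mi
    have A3 := hA _ mA
    have A4 := hA _ mB
    have A5 := hA _ mC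
    have A6 := hA _ mD
    clear hA
    unfold Op at *
    grind (splits := 30)

lemma Good.restrict (G : Good V f a b c d) {i : α} (hi : i ∈ V) (oi : Op f a b c d i) :
    Good ((V.erase i).erase (f i)) f a b c d := by
  have nC := G.notC hi oi.1 oi.2.1 oi.2.2.1 oi.2.2.2.1
  obtain ⟨o1, o2, o3, o4, -⟩ := oi
  refine ⟨G.hab, G.hbc, G.hcd, ?_, ?_, ?_, ?_, G.fa, G.fb, G.fc, G.fd, ?_, ?_, ?_, ?_⟩
  · simp [G.ha, o1.symm, nC.1.symm]
  · simp [G.hb, o2.symm, nC.2.1.symm]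
  · simp [G.hc, o3.symm, nC.2.2.1.symm]
  · simp [G.hd, o4.symm, nC.2.2.2.symm]
  · intro x hx
    simp only [mem_erase] at hx ⊢
    have := G.inv x hx.2.2
    have := G.inv i hi
    exact ⟨by grind, by grind, G.maps x hx.2.2⟩
  · intro x hx; simp only [mem_erase] at hx; exact G.inv x hx.2.2
  · intro x hx; simp only [mem_erase] at hx; exact G.ne x hx.2.2
  · intro x hx h1 h2 h3 h4 j hj; simp only [mem_erase] at hx hj
    exact G.nc x hx.2.2 h1 h2 h3 h4 j hj.2.2

lemma Good.congr (G : Good V f a b c d) (h : ∀ x ∈ V, g x = f x) : Good V g a b c d := by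
  refine ⟨G.hab, G.hbc, G.hcd, G.ha, G.hb, G.hc, G.hd, ?_, ?_, ?_, ?_, ?_, ?_, ?_, ?_⟩
  · rw [h _ G.ha, G.fa]
  · rw [h _ G.hb, G.fb]
  · rw [h _ G.hc, G.fc]
  · rw [h _ G.hd, G.fd]
  · intro x hx; rw [h x hx]; exact G.maps x hx
  · intro x hx; rw [h x hx, h _ (G.maps x hx)]; exact G.inv x hx
  · intro x hx; rw [h x hx]; exact G.ne x hx
  · intro x hx h1 h2 h3 h4 j hj; rw [h x hx, h j hj]; exact G.nc x hx h1 h2 h3 h4 j hj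

lemma Good.extend {i j : α} (G : Good ((V.erase i).erase j) f a b c d) (hi : i ∈ V) (hj : j ∈ V)
    (hA : Adj V i j) (fi : f i = j) (fj : f j = i) :
    Good V f a b c d ∧ Op f a b c d i ∧ ¬ Op f a b c d j := by
  have ma := G.ha
  have mb := G.hb
  have mc := G.hc
  have md := G.hd
  simp only [mem_erase] at ma mb mc md
  have hij : i ≠ j := by rintro rfl; rcases hA with h | h <;> exact lt_irrefl _ h.1
  have key : ∀ x ∈ V, x ≠ i → x ≠ j → x ∈ ((V.erase i).erase j) := by
    intro x hx h1 h2; simp [*]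
  refine ⟨⟨G.hab, G.hbc, G.hcd, ma.2.2, mb.2.2, mc.2.2, md.2.2, G.fa, G.fb, G.fc, G.fd,
    ?_, ?_, ?_, ?_⟩, ?_, ?_⟩
  · intro x hx
    by_cases h1 : x = i
    · rw [h1, fi]; exact hj
    by_cases h2 : x = j
    · rw [h2, fj]; exact hi
    have := G.maps x (key x hx h1 h2)
    simp only [mem_erase] at this
    exact this.2.2
  · intro x hx
    by_cases h1 : x = i
    · rw [h1, fi, fj]
    by_cases h2 : x = j
    · rw [h2, fj, fi]
    exact G.inv x (key x hx h1 h2)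
  · intro x hx
    by_cases h1 : x = i
    · rw [h1, fi]; exact hij.symm
    by_cases h2 : x = j
    · rw [h2, fj]; exact hij
    exact G.ne x (key x hx h1 h2)
  · intro x hx n1 n2 n3 n4 y hy l1 l2
    have mf : ∀ x ∈ V, x ≠ i → x ≠ j → f x ∈ V ∧ f x ≠ i ∧ f x ≠ j := by
      intro x hx h1 h2
      have := G.maps x (key x hx h1 h2)
      simp only [mem_erase] at this
      exact ⟨this.2.2, this.2.1, this.1⟩
    by_cases hxx : x = i ∨ x = j
    · have A := fun h1 h2 => mf y hy h1 h2
      unfold Adj at hA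
      have := hA.imp (fun h => h.2 y hy) (fun h => h.2 y hy)
      have B : f y ∈ V → _ := fun hh => hA.imp (fun h => h.2 (f y) hh) (fun h => h.2 (f y) hh)
      grind
    · push Not at hxx
      have M := mf x hx hxx.1 hxx.2
      by_cases hyy : y = i ∨ y = j
      · unfold Adj at hA
        have := hA.imp (fun h => h.2 x hx) (fun h => h.2 x hx)
        have := hA.imp (fun h => h.2 (f x) M.1) (fun h => h.2 (f x) M.1)
        grind
      · push Not at hyy
        exact G.nc x (key x hx hxx.1 hxx.2) n1 n2 n3 n4 y (key y hy hyy.1 hyy.2) l1 l2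
  · unfold Op
    unfold Adj at hA
    have := hA.imp (fun h => h.2 a ma.2.2) (fun h => h.2 a ma.2.2)
    grind
  · unfold Op
    unfold Adj at hA
    have := hA.imp (fun h => h.2 a ma.2.2) (fun h => h.2 a ma.2.2)
    grind

lemma good_exists (m : ℕ) : ∀ (V S : Finset α), S ⊆ V → S.card = m → V.card = 2 * m + 4 →
    ∃ f a b c d, Good V f a b c d ∧ ∀ i ∈ V, Op f a b c d i ↔ i ∈ S := by
  induction m with
  | zero =>
    intro V S hS h1 h2
    obtain ⟨a, b, c, d, hab, hbc, hcd, hV⟩ := four_sorted V (by omega)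
    have hS0 : S = ∅ := Finset.card_eq_zero.1 h1
    have hac := hab.trans hbc
    have hbd := hbc.trans hcd
    have had := hab.trans hbd
    refine ⟨fun x => if x = a then c else if x = b then d else if x = c then a else b,
      a, b, c, d, ⟨hab, hbc, hcd, ?_, ?_, ?_, ?_, ?_, ?_, ?_, ?_, ?_, ?_, ?_, ?_⟩, ?_⟩
    all_goals try simp only [hV, hS0, Op]
    all_goals grind
  | succ m ih =>
    intro V S hS h1 h2
    obtain ⟨i, hi, j, hj, hjS, hA⟩ := exists_adj V S hS (Finset.card_pos.1 (by omega))
      (Finset.card_pos.1 (by rw [Finset.card_sdiff_of_subset hS]; omega))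
    have hij : i ≠ j := by rintro rfl; exact hjS hi
    obtain ⟨f, a, b, c, d, G, hO⟩ := ih ((V.erase i).erase j) (S.erase i)
      (by intro x hx; simp only [mem_erase] at hx ⊢
          exact ⟨by rintro rfl; exact hjS hx.2, hx.1, hS hx.2⟩)
      (by rw [Finset.card_erase_of_mem hi]; omega)
      (by rw [Finset.card_erase_of_mem (by simp [hj, hij.symm]),
            Finset.card_erase_of_mem (hS hi)]; omega)
    let g : α → α := fun x => if x = i then j else if x = j then i else f x
    have hg : ∀ x ∈ ((V.erase i).erase j), g x = f x := by
      intro x hx; simp only [mem_erase] at hx; simp [g, hx.1, hx.2.1]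
    obtain ⟨G1, o1, o2⟩ := (G.congr hg).extend (hS hi) hj hA (by simp [g]) (by simp [g, hij.symm])
    refine ⟨g, a, b, c, d, G1, fun x hx => ?_⟩
    by_cases hxi : x = i
    · subst hxi; simp [o1, hi]
    by_cases hxj : x = j
    · subst hxj; simp [o2, hjS]
    have hm : x ∈ ((V.erase i).erase j) := by simp [*]
    have := hO x hm
    unfold Op at this ⊢
    rw [hg x hm, this]; simp [hxi]

lemma good_unique (m : ℕ) : ∀ (V S : Finset α), S ⊆ V → S.card = m → V.card = 2 * m + 4 →
    ∀ f a b c d, Good V f a b c d → (∀ i ∈ V, Op f a b c d i ↔ i ∈ S) →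
    ∀ f' a' b' c' d', Good V f' a' b' c' d' → (∀ i ∈ V, Op f' a' b' c' d' i ↔ i ∈ S) →
    ∀ x ∈ V, f x = f' x := by
  induction m with
  | zero =>
    intro V S hS h1 h2 f a b c d G hO f' a' b' c' d' G' hO'
    have hS0 : S = ∅ := Finset.card_eq_zero.1 h1
    subst hS0
    have key : ∀ f a b c d, Good V f a b c d → (∀ i ∈ V, Op f a b c d i ↔ i ∈ (∅ : Finset α)) →
        ∀ x, (x = a ∨ x = b ∨ x = c ∨ x = d) ↔ x ∈ V := by
      intro f a b c d G hO x
      constructor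
      · have := G.ha; have := G.hb; have := G.hc; have := G.hd
        grind
      · intro hx
        by_contra hcon
        push Not at hcon
        have h := G.op_swap hx hcon.1 hcon.2.1 hcon.2.2.1 hcon.2.2.2
        rw [hO _ hx, hO _ (G.maps x hx)] at h
        simp at h
    have k1 := key _ _ _ _ _ G hO
    have k2 := key _ _ _ _ _ G' hO'
    obtain ⟨rfl, rfl, rfl, rfl⟩ := sorted_unique G.hab G.hbc G.hcd G'.hab G'.hbc G'.hcd
      (fun x => (k1 x).trans (k2 x).symm)
    intro x hx
    rcases (k1 x).2 hx with rfl | rfl | rfl | rfl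
    · rw [G.fa, G'.fa]
    · rw [G.fb, G'.fb]
    · rw [G.fc, G'.fc]
    · rw [G.fd, G'.fd]
  | succ m ih =>
    intro V S hS h1 h2 f a b c d G hO f' a' b' c' d' G' hO'
    obtain ⟨i, hi, j, hj, hjS, hA⟩ := exists_adj V S hS (Finset.card_pos.1 (by omega))
      (Finset.card_pos.1 (by rw [Finset.card_sdiff_of_subset hS]; omega))
    have hij : i ≠ j := by rintro rfl; exact hjS hi
    have oi := (hO i (hS hi)).2 hi
    have oi' := (hO' i (hS hi)).2 hi
    have e1 := G.adj_eq (hS hi) hj hA oi (by rw [hO j hj]; exact hjS)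
    have e2 := G'.adj_eq (hS hi) hj hA oi' (by rw [hO' j hj]; exact hjS)
    have R := G.restrict (hS hi) oi
    have R' := G'.restrict (hS hi) oi'
    rw [e1] at R
    rw [e2] at R'
    have := ih ((V.erase i).erase j) (S.erase i)
      (by intro x hx; simp only [mem_erase] at hx ⊢
          exact ⟨by rintro rfl; exact hjS hx.2, hx.1, hS hx.2⟩)
      (by rw [Finset.card_erase_of_mem hi]; omega)
      (by rw [Finset.card_erase_of_mem (by simp [hj, hij.symm]),
            Finset.card_erase_of_mem (hS hi)]; omega)
      f a b c d R (by intro x hx; simp only [mem_erase] at hx ⊢; rw [hO x hx.2.2]; simp [hx.2.1])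
      f' a' b' c' d' R'
      (by intro x hx; simp only [mem_erase] at hx ⊢; rw [hO' x hx.2.2]; simp [hx.2.1])
    intro x hx
    by_cases hxi : x = i
    · rw [hxi, e1, e2]
    by_cases hxj : x = j
    · have t1 := G.inv i (hS hi)
      have t2 := G'.inv i (hS hi)
      rw [e1] at t1
      rw [e2] at t2
      rw [hxj, t1, t2]
    exact this x (by simp [*])

lemma Good.card (G : Good V f a b c d) (S : Finset α) (hS : S ⊆ V)
    (hO : ∀ i ∈ V, Op f a b c d i ↔ i ∈ S) : V.card = 2 * S.card + 4 := by
  have hV : V = (S ∪ S.image f) ∪ {a, b, c, d} := by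
    ext x
    simp only [mem_union, mem_image, mem_insert, mem_singleton]
    constructor
    · intro hx
      by_cases hC : x = a ∨ x = b ∨ x = c ∨ x = d
      · exact Or.inr hC
      push Not at hC
      by_cases hxS : x ∈ S
      · exact Or.inl (Or.inl hxS)
      · refine Or.inl (Or.inr ⟨f x, ?_, G.inv x hx⟩)
        rw [← hO _ (G.maps x hx), G.op_swap hx hC.1 hC.2.1 hC.2.2.1 hC.2.2.2, hO x hx]
        exact hxS
    · rintro ((h | ⟨y, hy, rfl⟩) | rfl | rfl | rfl | rfl)
      · exact hS h
      · exact G.maps y (hS hy)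
      · exact G.ha
      · exact G.hb
      · exact G.hc
      · exact G.hd
  have hop : ∀ x ∈ S, Op f a b c d x := fun x hx => (hO x (hS hx)).2 hx
  rw [hV, Finset.card_union_of_disjoint, Finset.card_union_of_disjoint,
    Finset.card_image_of_injOn]
  · have : ({a, b, c, d} : Finset α).card = 4 := by
      have h1 := G.hab
      have h2 := G.hbc
      have h3 := G.hcd
      rw [Finset.card_eq_succ]
      refine ⟨a, {b, c, d}, ?_, rfl, ?_⟩
      · simp [h1.ne, (h1.trans h2).ne, (h1.trans (h2.trans h3)).ne]
      · rw [Finset.card_eq_three]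
        exact ⟨b, c, d, h2.ne, (h2.trans h3).ne, h3.ne, rfl⟩
    omega
  · intro x hx y hy hxy
    rw [← G.inv x (hS hx), ← G.inv y (hS hy)]
    exact congrArg f hxy
  · rw [Finset.disjoint_left]
    intro x hx hx'
    obtain ⟨y, hy, rfl⟩ := Finset.mem_image.1 hx'
    have o := hop y hy
    exact (G.op_swap (hS hy) o.1 o.2.1 o.2.2.1 o.2.2.2.1).1 (hop _ hx) o
  · rw [Finset.disjoint_left]
    intro x hx hx'
    simp only [mem_union, mem_image, mem_insert, mem_singleton] at hx hx'
    have : x ≠ a ∧ x ≠ b ∧ x ≠ c ∧ x ≠ d := by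
      rcases hx with h | ⟨y, hy, rfl⟩
      · have o := hop x h
        exact ⟨o.1, o.2.1, o.2.2.1, o.2.2.2.1⟩
      · have o := hop y hy
        exact G.notC (hS hy) o.1 o.2.1 o.2.2.1 o.2.2.2.1
    tauto

end

lemma circBtw_iff {n : ℕ} (a b x : Fin n) :
    CircBtw a b x ↔ (a < x ∧ x < b) ∨ (b < a ∧ a < x) ∨ (x < b ∧ b < a) := by
  unfold CircBtw
  rcases lt_trichotomy a x with h | h | h <;> rcases lt_trichotomy a b with h' | h' | h' <;>
  simp only [Fin.lt_def, Fin.ext_iff, Fin.sub_def] at * <;>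
  have := a.2 <;> have := b.2 <;> have := x.2
  all_goals
    have e1 : (n - a.1 + x.1) % n = if a.1 ≤ x.1 then x.1 - a.1 else n + x.1 - a.1 := by
      split_ifs
      · rw [show n - a.1 + x.1 = (x.1 - a.1) + n by omega, Nat.add_mod_right,
          Nat.mod_eq_of_lt (by omega)]
      · rw [Nat.mod_eq_of_lt (by omega)]; omega
    have e2 : (n - a.1 + b.1) % n = if a.1 ≤ b.1 then b.1 - a.1 else n + b.1 - a.1 := by
      split_ifs
      · rw [show n - a.1 + b.1 = (b.1 - a.1) + n by omega, Nat.add_mod_right,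
          Nat.mod_eq_of_lt (by omega)]
      · rw [Nat.mod_eq_of_lt (by omega)]; omega
    rw [e1, e2]
    split_ifs <;> omega

lemma good_crossVert {n : ℕ} {f : Fin n → Fin n} {a b c d : Fin n}
    (G : Good univ f a b c d) (i : Fin n) :
    CrossVert f i ↔ (i = a ∨ i = b ∨ i = c ∨ i = d) := by
  have h1 := G.hab
  have h2 := G.hbc
  have h3 := G.hcd
  have fa := G.fa; have fb := G.fb; have fc := G.fc; have fd := G.fd
  constructor
  · rintro ⟨j, hj1, hj2, hX⟩
    by_contra hC
    push Not at hC
    have nC := G.notC (mem_univ i) hC.1 hC.2.1 hC.2.2.1 hC.2.2.2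
    have N1 := G.nc i (mem_univ i) hC.1 hC.2.1 hC.2.2.1 hC.2.2.2
    have N2 := G.nc (f i) (mem_univ _) nC.1 nC.2.1 nC.2.2.1 nC.2.2.2
    have i1 := G.inv i (mem_univ i)
    have i2 := G.inv j (mem_univ j)
    rw [i1] at N2
    have a1 := N1 j (mem_univ _); have a2 := N1 (f j) (mem_univ _)
    have a3 := N2 j (mem_univ _); have a4 := N2 (f j) (mem_univ _)
    rw [i2] at a2 a4
    have := G.ne i (mem_univ _); have := G.ne j (mem_univ _)
    unfold ChordsCross Xor' at hX
    simp only [circBtw_iff] at hX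
    clear N1 N2 fa fb fc fd h1 h2 h3 G
    have : f j ≠ i := by rintro rfl; exact hj2 i2.symm
    have : f j ≠ f i := by intro h; rw [h, i1] at i2; exact hj1 i2.symm
    grind
  · have : ∀ j, j ≠ i → j ≠ f i → ChordsCross f i j → CrossVert f i :=
      fun j h1 h2 h3 => ⟨j, h1, h2, h3⟩
    simp only [ChordsCross, Xor', circBtw_iff] at this
    rintro (rfl | rfl | rfl | rfl)
    · apply this b <;> grind
    · apply this c <;> grind
    · apply this b <;> grind
    · apply this c <;> grind

lemma exists_good {n : ℕ} {f : Fin n → Fin n} (hf : IsPairing f) (X : Finset (Fin n))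
    (hX : ∀ i, i ∈ X ↔ CrossVert f i) (h4 : X.card = 4) :
    ∃ a b c d, Good univ f a b c d := by
  obtain ⟨inv, ne⟩ := hf
  have cross : ∀ i j, CrossVert f i ∨ ¬ (i < j ∧ j < f i ∧ (f j < i ∨ f i < f j)) := by
    intro i j
    by_cases h : i < j ∧ j < f i ∧ (f j < i ∨ f i < f j)
    · refine Or.inl ⟨j, h.1.ne', h.2.1.ne, ?_⟩
      simp only [ChordsCross, Xor', circBtw_iff]
      grind
    · exact Or.inr h
  -- every crossing gives a sorted one
  obtain ⟨i, hi⟩ : X.Nonempty := Finset.card_pos.1 (by omega)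
  obtain ⟨j, hj1, hj2, hc⟩ := (hX i).1 hi
  have i1 := inv i
  have i2 := inv j
  have : ∃ a b, a < b ∧ b < f a ∧ f a < f b := by
    have n1 := ne i
    have n2 := ne j
    have n3 : f j ≠ i := by rintro rfl; exact hj2 i2.symm
    have n4 : f j ≠ f i := by intro h; rw [h, i1] at i2; exact hj1 i2.symm
    simp only [ChordsCross, Xor', circBtw_iff] at hc
    by_contra hcon
    push Not at hcon
    have c1 := hcon i j
    have c2 := hcon (f i) j
    have c3 := hcon i (f j)
    have c4 := hcon (f i) (f j)
    have c5 := hcon j i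
    have c6 := hcon (f j) i
    have c7 := hcon j (f i)
    have c8 := hcon (f j) (f i)
    rw [i1] at *
    rw [i2] at *
    clear hcon cross hX inv ne
    grind
  obtain ⟨a, b, hab, hba, hfab⟩ := this
  have ia := inv a
  have ib := inv b
  have cv : ∀ x j, j ≠ x → j ≠ f x → ChordsCross f x j → x ∈ X :=
    fun x j h1 h2 h3 => (hX x).2 ⟨j, h1, h2, h3⟩
  simp only [ChordsCross, Xor', circBtw_iff] at cv
  have ma : a ∈ X := by apply cv a b <;> grind
  have mb : b ∈ X := by apply cv b (f a) <;> grind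
  have mc : f a ∈ X := by apply cv (f a) b <;> grind
  have md : f b ∈ X := by apply cv (f b) (f a) <;> grind
  have hsub : ({a, b, f a, f b} : Finset (Fin n)) = X := by
    apply Finset.eq_of_subset_of_card_le
    · intro x; simp only [mem_insert, mem_singleton]; rintro (rfl | rfl | rfl | rfl) <;> assumption
    · rw [h4, Finset.card_insert_of_notMem, Finset.card_insert_of_notMem,
        Finset.card_insert_of_notMem, Finset.card_singleton] <;>
      simp only [mem_insert, mem_singleton] <;> grind
  refine ⟨a, b, f a, f b, hab, hba, hfab, mem_univ _, mem_univ _, mem_univ _, mem_univ _,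
    rfl, rfl, ia, ib, fun _ _ => mem_univ _, fun i _ => inv i, fun i _ => ne i, ?_⟩
  intro i _ h1 h2 h3 h4 j _ l1 l2
  have hni : ¬ CrossVert f i := by
    rw [← hX, ← hsub]; simp [h1, h2, h3, h4]
  have := (cross i j).resolve_left hni
  have e1 := inv i
  have e2 := inv j
  have : f j ≠ i := by rintro rfl; rw [e2] at l2; exact lt_irrefl _ l2
  have : f j ≠ f i := by intro h; rw [h, e1] at e2; exact l1.ne e2
  grind

open Classical in
lemma mem_A_iff {k : ℕ} (f : Fin (2*k) → Fin (2*k)) :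
    f ∈ (pairings k).filter (fun f => crossCount k f = 4) ↔ ∃ a b c d, Good univ f a b c d := by
  rw [mem_filter]
  unfold pairings
  rw [mem_filter]
  unfold crossCount
  simp only [mem_univ, true_and]
  constructor
  · rintro ⟨hf, h⟩
    exact exists_good hf _ (fun i => by simp) h
  · rintro ⟨a, b, c, d, G⟩
    refine ⟨⟨fun i => G.inv i (mem_univ i), fun i => G.ne i (mem_univ i)⟩, ?_⟩
    have h1 := G.hab
    have h2 := G.hbc
    have h3 := G.hcd
    have : univ.filter (fun i => CrossVert f i) = {a, b, c, d} := by
      ext x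
      simp [good_crossVert G]
    rw [this, Finset.card_insert_of_notMem, Finset.card_insert_of_notMem,
        Finset.card_insert_of_notMem, Finset.card_singleton] <;>
      simp only [mem_insert, mem_singleton] <;> grind

/-- The number of pairings of `2k` vertices with exactly `4` crossing vertices
is `C(2k, k-2)`. -/
theorem Cr_four (k : ℕ) (hk : 2 ≤ k) : Cr k 4 = Nat.choose (2*k) (k - 2) := by
  classical
  have hB : (powersetCard (k - 2) (univ : Finset (Fin (2*k)))).card = Nat.choose (2*k) (k - 2) := by
    simp
  rw [← hB]
  unfold Cr
  have hcu : (univ : Finset (Fin (2*k))).card = 2 * (k - 2) + 4 := by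
    simp; omega
  apply le_antisymm
  · have : ∀ f ∈ (pairings k).filter (fun f => crossCount k f = 4),
        ∃ S : Finset (Fin (2*k)), S.card = k - 2 ∧ ∃ a b c d, Good univ f a b c d ∧
          ∀ i ∈ univ, Op f a b c d i ↔ i ∈ S := by
      intro f hf
      obtain ⟨a, b, c, d, G⟩ := (mem_A_iff f).1 hf
      have hO : ∀ i ∈ univ, Op f a b c d i ↔ i ∈ univ.filter (Op f a b c d) := by simp
      have := G.card _ (subset_univ _) hO
      exact ⟨_, by omega, a, b, c, d, G, hO⟩
    choose! s hs1 hs2 using this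
    refine Finset.card_le_card_of_injOn s (fun f hf => ?_) (fun f hf g hg hfg => ?_)
    · simpa using hs1 f hf
    · obtain ⟨a, b, c, d, G, hO⟩ := hs2 f hf
      obtain ⟨a', b', c', d', G', hO'⟩ := hs2 g hg
      funext x
      exact good_unique (k - 2) univ (s f) (subset_univ _) (hs1 f hf) hcu f a b c d G hO
        g a' b' c' d' G' (by rw [hfg]; exact hO') x (mem_univ x)
  · have : ∀ S ∈ powersetCard (k - 2) (univ : Finset (Fin (2*k))),
        ∃ f : Fin (2*k) → Fin (2*k), ∃ a b c d, Good univ f a b c d ∧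
          ∀ i ∈ univ, Op f a b c d i ↔ i ∈ S := by
      intro S hS
      exact good_exists (k - 2) univ S (subset_univ _) (mem_powersetCard.1 hS).2 hcu
    haveI hne : Nonempty (Fin (2*k) → Fin (2*k)) := ⟨id⟩
    choose! F hF using this
    refine Finset.card_le_card_of_injOn F (fun S hS => ?_) (fun S hS T hT hST => ?_)
    · obtain ⟨a, b, c, d, G, -⟩ := hF S hS
      exact (mem_A_iff _).2 ⟨a, b, c, d, G⟩
    · obtain ⟨a, b, c, d, G, hO⟩ := hF S hS
      obtain ⟨a', b', c', d', G', hO'⟩ := hF T hT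
      rw [← hST] at G' hO'
      obtain ⟨rfl, rfl, rfl, rfl⟩ := sorted_unique G.hab G.hbc G.hcd G'.hab G'.hbc G'.hcd
        (fun x => (good_crossVert G x).symm.trans (good_crossVert G' x))
      ext x
      rw [← hO x (mem_univ x), ← hO' x (mem_univ x)]
end

section
/- The number of pairings of 2k vertices on a circle in which exactly 6 vertices are involved in crossings equals 4 * binomial(2k, k-3). -/
open Finset

/-! ### Arithmetic on the circle -/

lemma rv {n : ℕ} (a x : Fin n) :
    (a.val ≤ x.val ∧ (x - a).val = x.val - a.val) ∨
      (x.val < a.val ∧ (x - a).val = n + x.val - a.val) := by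
  rcases le_or_gt a x with h | h
  · left
    exact ⟨h, Fin.coe_sub_iff_le.2 h⟩
  · right
    exact ⟨h, Fin.coe_sub_iff_lt.2 h⟩

/-- `c` matches every opener in `A` with a closer, in the cyclic parenthesis way. -/
structure Good_s6 {n : ℕ} (A : Finset (Fin n)) (c : Fin n → Fin n) : Prop where
  notA : ∀ i ∈ A, c i ∉ A
  inj : ∀ i ∈ A, ∀ j ∈ A, c i = c j → i = j
  nest : ∀ i ∈ A, ∀ x ∈ A, 0 < (x - i).val → (x - i).val < (c i - i).val →
    (x - i).val < (c x - i).val ∧ (c x - i).val < (c i - i).val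
  fill : ∀ i ∈ A, ∀ x, x ∉ A → 0 < (x - i).val → (x - i).val < (c i - i).val →
    ∃ x' ∈ A, 0 < (x' - i).val ∧ (x' - i).val < (c i - i).val ∧ c x' = x

lemma Good_s6.unique {n : ℕ} {A : Finset (Fin n)} {c g : Fin n → Fin n}
    (hc : Good_s6 A c) (hg : Good_s6 A g) : ∀ (m : ℕ) (i : Fin n), i ∈ A → (c i - i).val = m →
      c i = g i := by
  intro m
  induction m using Nat.strong_induction_on with
  | _ m ih =>
    intro i hi hm
    -- openers strictly inside the arc agree
    have key : ∀ x ∈ A, 0 < (x - i).val → (x - i).val < (c i - i).val → c x = g x := by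
      intro x hx h0 h1
      obtain ⟨h2, h3⟩ := hc.nest i hi x hx h0 h1
      refine ih (c x - x).val ?_ x hx rfl
      have := rv x (c x); have := rv i x; have := rv i (c x); have := rv i (c i)
      omega
    have hci : c i ≠ i := fun h => hc.notA i hi (by rw [h]; exact hi)
    have hgi : g i ≠ i := fun h => hg.notA i hi (by rw [h]; exact hi)
    have p1 : 0 < (c i - i).val := by
      have := rv i (c i); have : (c i).val ≠ i.val := fun h => hci (Fin.ext h)
      omega
    have p2 : 0 < (g i - i).val := by
      have := rv i (g i); have : (g i).val ≠ i.val := fun h => hgi (Fin.ext h)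
      omega
    rcases lt_trichotomy (g i - i).val (c i - i).val with h | h | h
    · exfalso
      obtain ⟨x', hx', h0, h1, h2⟩ := hc.fill i hi (g i) (hg.notA i hi) p2 h
      rw [key x' hx' h0 h1] at h2
      have := hg.inj _ hx' _ hi h2
      subst this
      have := rv x' x'
      omega
    · have := rv i (c i); have := rv i (g i)
      apply Fin.ext
      omega
    · exfalso
      obtain ⟨x', hx', h0, h1, h2⟩ := hg.fill i hi (c i) (hc.notA i hi) p1 h
      obtain ⟨h3, h4⟩ := hg.nest i hi x' hx' h0 h1
      rw [h2] at h3
      have h5 := key x' hx' h0 h3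
      rw [h2] at h5
      have := hc.inj _ hx' _ hi h5
      subst this
      have := rv x' x'
      omega

/-! ### Existence of the cyclic parenthesis matching -/

/-- `y` closes `x` for the height function `H`. -/
def Closes (H : ℕ → ℤ) (x y : ℕ) : Prop :=
  x < y ∧ H (y + 1) = H x ∧ ∀ z, x < z → z ≤ y → H x < H z

lemma Closes.fun {H : ℕ → ℤ} {x y z : ℕ} (h : Closes H x y) (h' : Closes H x z) : y = z := by
  obtain ⟨a1, a2, a3⟩ := h
  obtain ⟨b1, b2, b3⟩ := h'
  rcases lt_trichotomy y z with h | h | h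
  · have := b3 (y + 1) (by omega) (by omega); omega
  · exact h
  · have := a3 (z + 1) (by omega) (by omega); omega

lemma Closes.inj {H : ℕ → ℤ} {x y z : ℕ} (h : Closes H x z) (h' : Closes H y z) : x = y := by
  obtain ⟨a1, a2, a3⟩ := h
  obtain ⟨b1, b2, b3⟩ := h'
  rcases lt_trichotomy x y with h | h | h
  · have := a3 y (by omega) (by omega); omega
  · exact h
  · have := b3 x (by omega) (by omega); omega

lemma Closes.shift {H : ℕ → ℤ} {n : ℕ} {δ : ℤ} (hd : ∀ m, H (m + n) = H m - δ) {x y : ℕ}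
    (h : Closes H x y) : Closes H (x + n) (y + n) := by
  obtain ⟨a1, a2, a3⟩ := h
  refine ⟨by omega, ?_, ?_⟩
  · have := hd (y + 1); have := hd x
    rw [show y + n + 1 = y + 1 + n by ring]
    omega
  · intro z h1 h2
    have h3 := a3 (z - n) (by omega) (by omega)
    have h4 := hd (z - n); have := hd x
    rw [show z - n + n = z by omega] at h4
    omega

lemma Closes.nest {H : ℕ → ℤ} {x y u v : ℕ} (h : Closes H x y) (h' : Closes H u v) (h1 : x < u)
    (h2 : u < y) : v < y := by
  obtain ⟨a1, a2, a3⟩ := h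
  obtain ⟨b1, b2, b3⟩ := h'
  have := a3 u h1 (by omega)
  by_contra hv
  rcases Nat.lt_or_ge y v with h | h
  · have := b3 (y + 1) (by omega) (by omega); omega
  · have : v = y := by omega
    subst this; omega

lemma Closes.exists {H : ℕ → ℤ} {n : ℕ} {δ : ℤ} (hδ : 0 < δ)
    (hd : ∀ m, H (m + n) = H m - δ) (hs : ∀ m, H (m + 1) = H m + 1 ∨ H (m + 1) = H m - 1)
    {x : ℕ} (hx : H (x + 1) = H x + 1) : ∃ y, Closes H x y ∧ y < x + n := by
  classical
  have hn : n ≠ 0 := by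
    rintro rfl
    have := hd 0; simp at this; omega
  have ex : ∃ y, x < y ∧ H (y + 1) ≤ H x := by
    refine ⟨x + n, by omega, ?_⟩
    have := hd (x + 1)
    rw [show x + n + 1 = x + 1 + n by ring]; omega
  obtain ⟨s1, s2⟩ := Nat.find_spec ex
  have hmin : ∀ z, x < z → z ≤ Nat.find ex → H x < H z := by
    intro z h1 h2
    rcases Nat.lt_or_ge (x + 1) z with h | h
    · have h3 := Nat.find_min ex (m := z - 1) (by omega)
      rw [show z - 1 + 1 = z by omega] at h3
      by_contra h4
      exact h3 ⟨by omega, by omega⟩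
    · have : z = x + 1 := by omega
      subst this; omega
  refine ⟨Nat.find ex, ⟨s1, ?_, hmin⟩, ?_⟩
  · have := hmin _ s1 le_rfl
    have := hs (Nat.find ex); omega
  · by_contra h
    have := hmin (x + n) (by omega) (by omega)
    have := hd x; omega

lemma Closes.fill {H : ℕ → ℤ} (hs : ∀ m, H (m + 1) = H m + 1 ∨ H (m + 1) = H m - 1)
    {x y u : ℕ} (h : Closes H x y) (h1 : x < u) (h2 : u < y) (hu : H (u + 1) = H u - 1) :
    ∃ x', x < x' ∧ x' < u ∧ Closes H x' u := by
  classical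
  obtain ⟨a1, a2, a3⟩ := h
  have h3 : H x < H (u + 1) := a3 (u + 1) (by omega) (by omega)
  let P : ℕ → Prop := fun z => H z ≤ H (u + 1)
  have hP : P x := by show H x ≤ H (u + 1); omega
  have hg : H (Nat.findGreatest P u) ≤ H (u + 1) := Nat.findGreatest_spec (P := P) h1.le hP
  have hmax : ∀ z, Nat.findGreatest P u < z → z ≤ u → H (u + 1) < H z := by
    intro z h4 h5
    have := Nat.findGreatest_is_greatest (P := P) h4 h5
    exact not_le.1 this
  have hxg : x ≤ Nat.findGreatest P u := Nat.le_findGreatest h1.le hP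
  have hle : Nat.findGreatest P u ≤ u := Nat.findGreatest_le u
  generalize Nat.findGreatest P u = g at *
  have hgu : g ≠ u := by rintro rfl; omega
  have h6 := hmax (g + 1) (by omega) (by omega)
  have h7 := hs g
  refine ⟨g, ?_, by omega, ⟨by omega, by omega, ?_⟩⟩
  · rcases Nat.lt_or_ge x g with h | h
    · exact h
    · have : x = g := by omega
      subst this; omega
  · intro z h8 h9
    have := hmax z h8 h9
    omega

lemma exists_good_s6 {n : ℕ} (A : Finset (Fin n)) (hA : 2 * A.card < n) : ∃ c, Good_s6 A c := by
  classical
  have hn : 0 < n := by omega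
  let q : ℕ → Fin n := fun m => ⟨m % n, Nat.mod_lt _ hn⟩
  have hqv : ∀ m, (q m).val = m % n := fun m => rfl
  let w : ℕ → ℤ := fun m => if q m ∈ A then 1 else -1
  let H : ℕ → ℤ := fun m => ∑ j ∈ Finset.range m, w j
  have hH : ∀ m, H (m + 1) = H m + w m := fun m => Finset.sum_range_succ _ _
  have hw : ∀ m, w (m + n) = w m := by
    intro m
    have : q (m + n) = q m := Fin.ext (by simp [hqv])
    simp only [w, this]
  have hHn : H n = 2 * A.card - n := by
    have h1 : H n = ∑ i : Fin n, w i := (Fin.sum_univ_eq_sum_range w n).symm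
    have h2 : ∀ i : Fin n, w i = 2 * (if i ∈ A then 1 else 0) - 1 := by
      intro i
      have : q i = i := Fin.ext (by simp [hqv, Nat.mod_eq_of_lt i.2])
      simp only [w, this]
      split_ifs <;> norm_num
    rw [h1, Finset.sum_congr rfl (fun i _ => h2 i), Finset.sum_sub_distrib, ← Finset.mul_sum]
    simp
  have hd : ∀ m, H (m + n) = H m - (n - 2 * A.card) := by
    intro m
    induction m with
    | zero => simp only [Nat.zero_add, hHn]; simp [H]
    | succ m ih =>
      rw [show m + 1 + n = m + n + 1 by ring, hH, hH, ih, hw]; ring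
  have hδ : (0 : ℤ) < n - 2 * A.card := by omega
  have hw1 : ∀ m, q m ∈ A → H (m + 1) = H m + 1 := by
    intro m hm; rw [hH]; simp [w, hm]
  have hw2 : ∀ m, q m ∉ A → H (m + 1) = H m - 1 := by
    intro m hm; rw [hH]; simp [w, hm]; ring
  have hs : ∀ m, H (m + 1) = H m + 1 ∨ H (m + 1) = H m - 1 := by
    intro m
    by_cases hm : q m ∈ A
    · exact Or.inl (hw1 m hm)
    · exact Or.inr (hw2 m hm)
  have hqi : ∀ i : Fin n, q i.val = i := fun i => Fin.ext (by simp [hqv, Nat.mod_eq_of_lt i.2])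
  have hex : ∀ i : Fin n, ∃ y, i ∈ A → Closes H i.val y ∧ y < i.val + n := by
    intro i
    by_cases hi : i ∈ A
    · obtain ⟨y, hy⟩ := Closes.exists hδ hd hs (x := i.val) (hw1 _ (by rw [hqi]; exact hi))
      exact ⟨y, fun _ => hy⟩
    · exact ⟨0, fun h => absurd h hi⟩
  choose C hC using hex
  have hmod : ∀ m, m < n + n → (m < n ∧ m % n = m) ∨ (n ≤ m ∧ m % n = m - n) := by
    intro m hm
    rcases Nat.lt_or_ge m n with h | h
    · exact Or.inl ⟨h, Nat.mod_eq_of_lt h⟩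
    · refine Or.inr ⟨h, ?_⟩
      rw [Nat.mod_eq_sub_mod h, Nat.mod_eq_of_lt (by omega)]
  -- relation at a lifted point
  have hlift : ∀ x y, x < n + n → Closes H x y → q x ∈ A → q (C (q x)) = q y := by
    intro x y hx hr ha
    obtain ⟨r1, r2⟩ := hC (q x) ha
    rw [hqv] at r1 r2
    rcases hmod x hx with ⟨h1, h2⟩ | ⟨h1, h2⟩
    · rw [h2] at r1
      rw [r1.fun hr]
    · rw [h2] at r1
      have r3 := r1.shift hd
      rw [show x - n + n = x by omega] at r3
      have := r3.fun hr
      apply Fin.ext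
      rw [hqv, hqv, ← this]; simp
  have hlift2 : ∀ x, x < n + n → q x ∈ A → ∃ y, Closes H x y ∧ y < x + n ∧ q (C (q x)) = q y := by
    intro x hx ha
    obtain ⟨y, h1, h2⟩ := Closes.exists hδ hd hs (x := x) (hw1 _ ha)
    exact ⟨y, h1, h2, hlift x y hx h1 ha⟩
  -- relative coordinates
  have hrel : ∀ (i : Fin n) (y : ℕ), i.val ≤ y → y < i.val + n → (q y - i).val = y - i.val := by
    intro i y h1 h2
    have := rv i (q y)
    rw [hqv] at this
    have := hmod y (by omega)
    omega
  have hback : ∀ (i x : Fin n), q (i.val + (x - i).val) = x := by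
    intro i x
    apply Fin.ext
    rw [hqv]
    have := rv i x
    have := hmod (i.val + (x - i).val) (by omega)
    omega
  refine ⟨fun i => q (C i), ?_, ?_, ?_, ?_⟩
  · intro i hi hm
    obtain ⟨⟨r1, r2, r3⟩, r4⟩ := hC i hi
    have := hw1 _ hm
    have := r3 _ r1 le_rfl
    omega
  · intro i hi j hj hij
    obtain ⟨r1, r2⟩ := hC i hi
    obtain ⟨r3, r4⟩ := hC j hj
    have e : C i % n = C j % n := congrArg Fin.val hij
    have m1 := hmod (C i) (by omega)
    have m2 := hmod (C j) (by omega)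
    have : C i = C j ∨ C i = C j + n ∨ C j = C i + n := by omega
    rcases this with h | h | h
    · rw [h] at r1; exact Fin.ext (r1.inj r3)
    · have := r3.shift hd
      rw [← h] at this
      have := r1.inj this
      omega
    · have := r1.shift hd
      rw [← h] at this
      have := r3.inj this
      omega
  · intro i hi x hx h0 h1
    obtain ⟨r1, r2⟩ := hC i hi
    have hb := hback i x
    have hl : i.val + (x - i).val < n + n := by omega
    obtain ⟨y, s1, s2, s3⟩ := hlift2 _ hl (by rw [hb]; exact hx)
    rw [hb] at s3
    simp only [s3]
    simp only [hrel i (C i) r1.1.le r2] at h1 ⊢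
    have h2 : y < C i := r1.nest s1 (by omega) (by omega)
    have h3 := s1.1
    rw [hrel i y (by omega) (by omega)]
    omega
  · intro i hi x hx h0 h1
    obtain ⟨r1, r2⟩ := hC i hi
    have hb := hback i x
    simp only [hrel i (C i) r1.1.le r2] at h1 ⊢
    obtain ⟨z, z1, z2, z3⟩ := Closes.fill hs r1 (u := i.val + (x - i).val) (by omega) (by omega)
      (hw2 _ (by rw [hb]; exact hx))
    have hz : q z ∈ A := by
      by_contra hz
      have := hw2 _ hz
      have := z3.2.2 (z + 1) (by omega) (by omega)
      omega
    refine ⟨q z, hz, ?_, ?_, ?_⟩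
    · rw [hrel i z (by omega) (by omega)]; omega
    · rw [hrel i z (by omega) (by omega)]; omega
    · rw [hlift z _ (by omega) z3 hz, hb]

/-! ### Crossings in linear terms -/

lemma circ_iff {n : ℕ} (a b x : Fin n) : CircBtw a b x ↔
    (a.val < b.val ∧ a.val < x.val ∧ x.val < b.val) ∨
      (b.val < a.val ∧ (a.val < x.val ∨ x.val < b.val)) := by
  unfold CircBtw
  have := rv a x; have := rv a b
  omega

/-- The chords `ab` and `cd` cross. -/
def Xc (a b c d : ℕ) : Prop :=
  (a < c ∧ c < b ∧ (d < a ∨ b < d)) ∨ (b < c ∧ c < a ∧ (d < b ∨ a < d)) ∨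
    (a < d ∧ d < b ∧ (c < a ∨ b < c)) ∨ (b < d ∧ d < a ∧ (c < b ∨ a < c))

instance (a b c d : ℕ) : Decidable (Xc a b c d) := by unfold Xc; infer_instance

lemma crossVert_iff {n : ℕ} {f : Fin n → Fin n} (hf : IsPairing f) (i : Fin n) :
    CrossVert f i ↔ ∃ j, Xc i.val (f i).val j.val (f j).val := by
  obtain ⟨h1, h2⟩ := hf
  have h3 : ∀ i, (f i).val ≠ i.val := fun i h => h2 i (Fin.ext h)
  unfold CrossVert
  constructor
  · rintro ⟨j, hj1, hj2, hx⟩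
    refine ⟨j, ?_⟩
    have a1 : j.val ≠ i.val := fun h => hj1 (Fin.ext h)
    have a2 : j.val ≠ (f i).val := fun h => hj2 (Fin.ext h)
    have a3 : (f j).val ≠ i.val := fun h => hj2 (by rw [← Fin.ext h, h1])
    have a4 : (f j).val ≠ (f i).val := fun h => hj1 (by rw [← h1 j, Fin.ext h, h1])
    have a5 := h3 i
    replace hx : (CircBtw i (f i) j ∧ ¬ CircBtw i (f i) (f j)) ∨
      (CircBtw i (f i) (f j) ∧ ¬ CircBtw i (f i) j) := hx
    rw [circ_iff, circ_iff] at hx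
    unfold Xc
    omega
  · rintro ⟨j, hx⟩
    refine ⟨j, ?_, ?_, ?_⟩
    · rintro rfl; unfold Xc at hx; omega
    · rintro rfl; rw [h1] at hx; unfold Xc at hx; omega
    · change (CircBtw i (f i) j ∧ ¬ CircBtw i (f i) (f j)) ∨
        (CircBtw i (f i) (f j) ∧ ¬ CircBtw i (f i) j)
      rw [circ_iff, circ_iff]
      unfold Xc at hx
      omega

lemma Xc_symm {a b c d : ℕ} (h : Xc a b c d) : Xc c d a b := by
  unfold Xc at *; omega

lemma Xc_swap {a b c d : ℕ} (h : Xc a b c d) : Xc b a c d := by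
  unfold Xc at *; omega

lemma crossVert_f {n : ℕ} {f : Fin n → Fin n} (hf : IsPairing f) (i : Fin n) :
    CrossVert f (f i) ↔ CrossVert f i := by
  rw [crossVert_iff hf, crossVert_iff hf, hf.1]
  exact ⟨fun ⟨j, h⟩ => ⟨j, Xc_swap h⟩, fun ⟨j, h⟩ => ⟨j, Xc_swap h⟩⟩

/-- A chord that is not crossed separates no other chord. -/
lemma noncross_inv {n : ℕ} {f : Fin n → Fin n} (hf : IsPairing f) {i : Fin n}
    (hi : ¬ CrossVert f i) {j : Fin n} (h : CircBtw i (f i) j) : CircBtw i (f i) (f j) := by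
  have h0 : ¬ Xc i.val (f i).val j.val (f j).val := fun h' => hi ((crossVert_iff hf i).2 ⟨j, h'⟩)
  have h3 : ∀ i, (f i).val ≠ i.val := fun i h => hf.2 i (Fin.ext h)
  have a3 : (f j).val = i.val → j.val = (f i).val := fun h => by rw [← Fin.ext h, hf.1]
  have a4 : (f j).val = (f i).val → j.val = i.val :=
    fun h => by rw [← hf.1 j, Fin.ext h, hf.1]
  have a5 := h3 i
  rw [circ_iff] at h ⊢
  unfold Xc at h0
  omega

/-! ### The four patterns on six points -/

/-- The four pairings of six points in which every point is crossing. -/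
def Pat : Finset (Fin 6 → Fin 6) :=
  {![3, 4, 5, 0, 1, 2], ![3, 5, 4, 0, 2, 1], ![2, 4, 0, 5, 1, 3], ![4, 3, 5, 1, 0, 2]}

lemma Pat_card : Pat.card = 4 := by decide

lemma mem_Pat {p : Fin 6 → Fin 6} : p ∈ Pat ↔ p = ![3, 4, 5, 0, 1, 2] ∨ p = ![3, 5, 4, 0, 2, 1] ∨
    p = ![2, 4, 0, 5, 1, 3] ∨ p = ![4, 3, 5, 1, 0, 2] := by
  simp [Pat]

lemma Pat_invol : ∀ p ∈ Pat, ∀ t, p (p t) = t := by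
  intro p hp
  rcases mem_Pat.1 hp with rfl | rfl | rfl | rfl <;> decide

lemma Pat_ne : ∀ p ∈ Pat, ∀ t, p t ≠ t := by
  intro p hp
  rcases mem_Pat.1 hp with rfl | rfl | rfl | rfl <;> decide

lemma Pat_cross : ∀ p ∈ Pat, ∀ t : Fin 6, ∃ s : Fin 6, Xc t.val (p t).val s.val (p s).val := by
  intro p hp
  unfold Xc
  rcases mem_Pat.1 hp with rfl | rfl | rfl | rfl <;> decide

lemma Pat_conn : ∀ p ∈ Pat, ∀ b : Fin 6 → Bool, (∀ t, b (p t) = b t) →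
    (∀ s t : Fin 6, Xc s.val (p s).val t.val (p t).val → b s = b t) → ∀ s, b s = b 0 := by
  intro p hp b h1 h2
  rcases mem_Pat.1 hp with rfl | rfl | rfl | rfl
  · have a0 := h1 0; have a1 := h1 1; have a2 := h1 2
    have b0 := h2 0 1 (by decide); have b1 := h2 0 2 (by decide)
    intro s; fin_cases s <;> simp_all
  · have a0 := h1 0; have a1 := h1 1; have a2 := h1 2
    have b0 := h2 0 1 (by decide); have b1 := h2 0 2 (by decide)
    intro s; fin_cases s <;> simp_all
  · have a0 := h1 1; have a1 := h1 0; have a2 := h1 3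
    have b0 := h2 1 0 (by decide); have b1 := h2 1 3 (by decide)
    intro s; fin_cases s <;> simp_all
  · have a0 := h1 2; have a1 := h1 0; have a2 := h1 1
    have b0 := h2 2 0 (by decide); have b1 := h2 2 1 (by decide)
    intro s; fin_cases s <;> simp_all

/-- Boolean check behind `Pat_complete`. -/
def patTest (a b c d e f : Fin 6) : Bool :=
  decide (∀ t : Fin 6, ∃ s : Fin 6, Xc t.val (![a, b, c, d, e, f] t).val s.val
      (![a, b, c, d, e, f] s).val)

/-- The four patterns, as value lists. -/
def patVals (a b c d e f : Fin 6) : Bool :=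
  decide ([a, b, c, d, e, f] = [3, 4, 5, 0, 1, 2] ∨ [a, b, c, d, e, f] = [3, 5, 4, 0, 2, 1] ∨
    [a, b, c, d, e, f] = [2, 4, 0, 5, 1, 3] ∨ [a, b, c, d, e, f] = [4, 3, 5, 1, 0, 2])

set_option synthInstance.maxHeartbeats 400000 in
set_option synthInstance.maxSize 2000 in
set_option maxRecDepth 100000 in
lemma Pat_aux : ∀ a : Fin 6, a ≠ 0 → ∀ b : Fin 6, b ≠ 1 ∧ (a = 1 ↔ b = 0) →
    ∀ c : Fin 6, c ≠ 2 ∧ (a = 2 ↔ c = 0) ∧ (b = 2 ↔ c = 1) →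
    ∀ d : Fin 6, d ≠ 3 ∧ (a = 3 ↔ d = 0) ∧ (b = 3 ↔ d = 1) ∧ (c = 3 ↔ d = 2) →
    ∀ e : Fin 6, e ≠ 4 ∧ (a = 4 ↔ e = 0) ∧ (b = 4 ↔ e = 1) ∧ (c = 4 ↔ e = 2) ∧
      (d = 4 ↔ e = 3) →
    ∀ f : Fin 6, f ≠ 5 ∧ (a = 5 ↔ f = 0) ∧ (b = 5 ↔ f = 1) ∧ (c = 5 ↔ f = 2) ∧
      (d = 5 ↔ f = 3) ∧ (e = 5 ↔ f = 4) →
    patTest a b c d e f = true → patVals a b c d e f = true := by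
  decide +kernel

lemma Pat_complete (p : Fin 6 → Fin 6) (h1 : ∀ t, p (p t) = t) (h2 : ∀ t, p t ≠ t)
    (h3 : ∀ t : Fin 6, ∃ s : Fin 6, Xc t.val (p t).val s.val (p s).val) : p ∈ Pat := by
  have hp : p = ![p 0, p 1, p 2, p 3, p 4, p 5] := by
    funext t; fin_cases t <;> rfl
  have hs : ∀ i j, p i = j ↔ p j = i := fun i j =>
    ⟨fun h => by rw [← h, h1], fun h => by rw [← h, h1]⟩
  have := Pat_aux _ (h2 0) _ ⟨h2 1, hs _ _⟩ _ ⟨h2 2, hs _ _, hs _ _⟩ _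
    ⟨h2 3, hs _ _, hs _ _, hs _ _⟩ _ ⟨h2 4, hs _ _, hs _ _, hs _ _, hs _ _⟩ _
    ⟨h2 5, hs _ _, hs _ _, hs _ _, hs _ _, hs _ _⟩
    (by unfold patTest; rw [← hp]; exact decide_eq_true h3)
  have := of_decide_eq_true this
  rw [mem_Pat, hp]
  simp only [List.cons.injEq, and_true] at this
  rcases this with h | h | h | h
  · left; simp only [h]
  · right; left; simp only [h]
  · right; right; left; simp only [h]
  · right; right; right; simp only [h]

lemma Xc_emb {n : ℕ} (e : Fin 6 ↪o Fin n) (a b c d : Fin 6) :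
    Xc (e a).val (e b).val (e c).val (e d).val ↔ Xc a.val b.val c.val d.val := by
  have h : ∀ x y, (e x).val < (e y).val ↔ x.val < y.val := fun x y => e.lt_iff_lt
  unfold Xc
  simp only [h]

/-! ### Pairings with six crossing vertices -/

lemma exists_pat {n : ℕ} {f : Fin n → Fin n} (hf : IsPairing f) (e : Fin 6 ↪o Fin n)
    (he : ∀ i, CrossVert f i ↔ ∃ t, e t = i) : ∃ p ∈ Pat, ∀ t, f (e t) = e (p t) := by
  have h1 : ∀ t, ∃ s, e s = f (e t) := fun t =>
    (he _).1 ((crossVert_f hf _).2 ((he _).2 ⟨t, rfl⟩))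
  choose p hp using h1
  refine ⟨p, Pat_complete p ?_ ?_ ?_, fun t => (hp t).symm⟩
  · intro t
    apply e.injective
    rw [hp, hp, hf.1]
  · intro t h
    have := hp t
    rw [h] at this
    exact hf.2 _ this.symm
  · intro t
    obtain ⟨j, hj⟩ := (crossVert_iff hf _).1 ((he _).2 ⟨t, rfl⟩)
    obtain ⟨s, rfl⟩ := (he j).1 ((crossVert_iff hf _).2 ⟨e t, Xc_symm hj⟩)
    rw [← hp, ← hp, Xc_emb] at hj
    exact ⟨s, hj⟩

lemma one_side {n : ℕ} {f : Fin n → Fin n} (hf : IsPairing f) (e : Fin 6 ↪o Fin n)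
    (he : ∀ i, CrossVert f i ↔ ∃ t, e t = i) {i : Fin n} (hi : ¬ CrossVert f i) :
    (∀ s, CrossVert f s → CircBtw i (f i) s) ∨ (∀ s, CrossVert f s → ¬ CircBtw i (f i) s) := by
  classical
  obtain ⟨p, hp, hpe⟩ := exists_pat hf e he
  have hinv : ∀ j, CircBtw i (f i) (f j) ↔ CircBtw i (f i) j := by
    intro j
    refine ⟨fun h => ?_, noncross_inv hf hi⟩
    have := noncross_inv hf hi h
    rwa [hf.1] at this
  have hne : ∀ j, CrossVert f j → j.val ≠ i.val ∧ j.val ≠ (f i).val := by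
    intro j hj
    constructor
    · intro h; rw [Fin.ext h] at hj; exact hi hj
    · intro h; rw [Fin.ext h, crossVert_f hf] at hj; exact hi hj
  have hX : ∀ s t, CrossVert f s → CrossVert f t → Xc s.val (f s).val t.val (f t).val →
      (CircBtw i (f i) s ↔ CircBtw i (f i) t) := by
    intro s t hs ht hx
    have a1 := hinv s
    have a2 := hinv t
    have a3 := hne s hs
    have a4 := hne t ht
    have a5 := hne (f s) ((crossVert_f hf s).2 hs)
    have a6 := hne (f t) ((crossVert_f hf t).2 ht)
    rw [circ_iff] at *
    rw [circ_iff] at *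
    unfold Xc at hx
    have : (f i).val ≠ i.val := fun h => hf.2 i (Fin.ext h)
    omega
  have hc := Pat_conn p hp (fun t => decide (CircBtw i (f i) (e t)))
    (by intro t; simp only [← hpe, hinv])
    (by
      intro s t hx
      rw [← Xc_emb e, ← hpe, ← hpe] at hx
      have := hX _ _ ((he _).2 ⟨s, rfl⟩) ((he _).2 ⟨t, rfl⟩) hx
      simp only [this])
  by_cases h0 : CircBtw i (f i) (e 0)
  · left
    intro s hs
    obtain ⟨t, rfl⟩ := (he s).1 hs
    have := hc t
    simpa [h0] using this
  · right
    intro s hs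
    obtain ⟨t, rfl⟩ := (he s).1 hs
    have := hc t
    simpa [h0] using this

open Classical in
/-- The openers of a pairing: non-crossing vertices whose clockwise arc has no crossing vertex. -/
noncomputable def Aof {n : ℕ} (f : Fin n → Fin n) : Finset (Fin n) :=
  Finset.univ.filter (fun i => ¬ CrossVert f i ∧ ∀ s, CrossVert f s → ¬ CircBtw i (f i) s)

lemma mem_Aof {n : ℕ} {f : Fin n → Fin n} {i : Fin n} :
    i ∈ Aof f ↔ ¬ CrossVert f i ∧ ∀ s, CrossVert f s → ¬ CircBtw i (f i) s := by
  simp [Aof]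

lemma Aof_xor {n : ℕ} {f : Fin n → Fin n} (hf : IsPairing f) (e : Fin 6 ↪o Fin n)
    (he : ∀ i, CrossVert f i ↔ ∃ t, e t = i) {i : Fin n} (hi : ¬ CrossVert f i) :
    f i ∈ Aof f ↔ i ∉ Aof f := by
  have hS : CrossVert f (e 0) := (he _).2 ⟨0, rfl⟩
  have hfi : ¬ CrossVert f (f i) := by rwa [crossVert_f hf]
  have hne : ∀ j, CrossVert f j → j.val ≠ i.val ∧ j.val ≠ (f i).val := by
    intro j hj
    constructor
    · intro h; rw [Fin.ext h] at hj; exact hi hj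
    · intro h; rw [Fin.ext h, crossVert_f hf] at hj; exact hi hj
  have hflip : ∀ s, CrossVert f s → (CircBtw (f i) i s ↔ ¬ CircBtw i (f i) s) := by
    intro s hs
    have := hne s hs
    have : (f i).val ≠ i.val := fun h => hf.2 i (Fin.ext h)
    rw [circ_iff, circ_iff]
    omega
  rw [mem_Aof, mem_Aof, hf.1]
  constructor
  · rintro ⟨-, h⟩ ⟨-, h'⟩
    exact h _ hS ((hflip _ hS).2 (h' _ hS))
  · intro h
    refine ⟨hfi, fun s hs hb => ?_⟩
    rcases one_side hf e he hi with h' | h'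
    · exact (hflip s hs).1 hb (h' s hs)
    · exact h ⟨hi, h'⟩

lemma good_Aof {n : ℕ} {f : Fin n → Fin n} (hf : IsPairing f) (e : Fin 6 ↪o Fin n)
    (he : ∀ i, CrossVert f i ↔ ∃ t, e t = i) : Good_s6 (Aof f) f := by
  have hnc : ∀ {i}, i ∈ Aof f → ¬ CrossVert f i := fun h => (mem_Aof.1 h).1
  have hS : CrossVert f (e 0) := (he _).2 ⟨0, rfl⟩
  refine ⟨?_, ?_, ?_, ?_⟩
  · intro i hi h
    exact (Aof_xor hf e he (hnc hi)).1 h hi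
  · intro i _ j _ h
    rw [← hf.1 i, h, hf.1]
  · intro i hi x hx h0 h1
    have h2 : CircBtw i (f i) (f x) := noncross_inv hf (hnc hi) ⟨h0, h1⟩
    refine ⟨?_, h2.2⟩
    have h3 := (mem_Aof.1 hi).2 _ hS
    have h4 := (mem_Aof.1 hx).2 _ hS
    have hne1 : (e 0).val ≠ i.val := fun h => hnc hi (by rw [← Fin.ext h]; exact hS)
    have hne2 : (e 0).val ≠ (f i).val := fun h =>
      hnc hi (by rw [← crossVert_f hf, ← Fin.ext h]; exact hS)
    have h5 : (f x).val ≠ x.val := fun h => hf.2 x (Fin.ext h)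
    unfold CircBtw at h2 h3 h4
    have := rv i x; have := rv i (f x); have := rv i (e 0); have := rv i (f i)
    have := rv x (f x); have := rv x (e 0)
    omega
  · intro i hi x hx h0 h1
    have h2 : CircBtw i (f i) (f x) := noncross_inv hf (hnc hi) ⟨h0, h1⟩
    have h3 : ¬ CrossVert f x := fun h => (mem_Aof.1 hi).2 x h ⟨h0, h1⟩
    exact ⟨f x, (Aof_xor hf e he h3).2 hx, h2.1, h2.2, hf.1 x⟩

lemma card_Aof {n : ℕ} {f : Fin n → Fin n} (hf : IsPairing f) (e : Fin 6 ↪o Fin n)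
    (he : ∀ i, CrossVert f i ↔ ∃ t, e t = i) : 2 * (Aof f).card + 6 = n := by
  classical
  have hinj : Function.Injective f := fun a b h => by rw [← hf.1 a, h, hf.1]
  have h1 : (Finset.univ : Finset (Fin n)) =
      (Aof f ∪ (Aof f).image f) ∪ Finset.univ.image e := by
    ext i
    simp only [mem_univ, mem_union, mem_image, true_iff, true_and]
    by_cases hi : CrossVert f i
    · exact Or.inr ((he i).1 hi)
    · left
      by_cases h : i ∈ Aof f
      · exact Or.inl h
      · exact Or.inr ⟨f i, (Aof_xor hf e he hi).2 h, hf.1 i⟩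
  have hd1 : Disjoint (Aof f) ((Aof f).image f) := by
    rw [Finset.disjoint_left]
    intro i hi h
    obtain ⟨j, hj, rfl⟩ := mem_image.1 h
    exact (good_Aof hf e he).notA j hj hi
  have hd2 : Disjoint (Aof f ∪ (Aof f).image f) (Finset.univ.image e) := by
    rw [Finset.disjoint_left]
    intro i hi h
    obtain ⟨t, -, rfl⟩ := mem_image.1 h
    have hS : CrossVert f (e t) := (he _).2 ⟨t, rfl⟩
    rcases mem_union.1 hi with h | h
    · exact (mem_Aof.1 h).1 hS
    · obtain ⟨j, hj, h'⟩ := mem_image.1 h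
      rw [← h', crossVert_f hf] at hS
      exact (mem_Aof.1 hj).1 hS
  have h2 := congrArg Finset.card h1
  rw [card_union_of_disjoint hd2, card_union_of_disjoint hd1, card_image_of_injective _ hinj,
    card_image_of_injective _ e.injective] at h2
  simp at h2
  omega

/-! ### Building a pairing from openers and a pattern -/

lemma build {n : ℕ} {A : Finset (Fin n)} {c : Fin n → Fin n} (hc : Good_s6 A c)
    (e : Fin 6 ↪o Fin n) (he : ∀ i, (∃ t, e t = i) ↔ i ∉ A ∧ ¬ ∃ x ∈ A, c x = i)
    {p : Fin 6 → Fin 6} (hp : p ∈ Pat) : ∃ f : Fin n → Fin n, IsPairing f ∧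
      (∀ i ∈ A, f i = c i) ∧ ∀ t, f (e t) = e (p t) := by
  classical
  have h : ∀ i, ∃ j, (i ∈ A → j = c i) ∧ (∀ x ∈ A, c x = i → j = x) ∧
      (∀ t, e t = i → j = e (p t)) := by
    intro i
    by_cases h1 : i ∈ A
    · refine ⟨c i, fun _ => rfl, ?_, ?_⟩
      · rintro x hx rfl; exact absurd h1 (hc.notA x hx)
      · intro t ht; exact absurd h1 ((he i).1 ⟨t, ht⟩).1
    · by_cases h2 : ∃ x ∈ A, c x = i
      · obtain ⟨x, hx, hxi⟩ := h2
        refine ⟨x, fun h => absurd h h1, ?_, ?_⟩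
        · intro y hy hyi; exact hc.inj _ hx _ hy (hxi.trans hyi.symm)
        · intro t ht; exact absurd ⟨x, hx, hxi⟩ ((he i).1 ⟨t, ht⟩).2
      · obtain ⟨t, ht⟩ := (he i).2 ⟨h1, h2⟩
        refine ⟨e (p t), fun h => absurd h h1, fun x hx hxi => absurd ⟨x, hx, hxi⟩ h2, ?_⟩
        intro s hs
        rw [e.injective (hs.trans ht.symm)]
  choose f f1 f2 f3 using h
  have g1 : ∀ i ∈ A, f i = c i := fun i hi => f1 i hi
  have g2 : ∀ i ∈ A, f (c i) = i := fun i hi => f2 _ i hi rfl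
  have g3 : ∀ t, f (e t) = e (p t) := fun t => f3 _ t rfl
  refine ⟨f, ⟨?_, ?_⟩, g1, g3⟩
  · intro i
    by_cases h1 : i ∈ A
    · rw [g1 i h1, g2 i h1]
    · by_cases h2 : ∃ x ∈ A, c x = i
      · obtain ⟨x, hx, rfl⟩ := h2
        rw [g2 x hx, g1 x hx]
      · obtain ⟨t, rfl⟩ := (he i).2 ⟨h1, h2⟩
        rw [g3, g3, Pat_invol p hp]
  · intro i
    by_cases h1 : i ∈ A
    · rw [g1 i h1]
      intro h
      have := hc.notA i h1
      rw [h] at this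
      exact this h1
    · by_cases h2 : ∃ x ∈ A, c x = i
      · obtain ⟨x, hx, rfl⟩ := h2
        rw [g2 x hx]
        intro h
        have := hc.notA x hx
        rw [← h] at this
        exact this hx
      · obtain ⟨t, rfl⟩ := (he i).2 ⟨h1, h2⟩
        rw [g3]
        intro h
        exact Pat_ne p hp t (e.injective h)

lemma build_props {n : ℕ} {A : Finset (Fin n)} {c : Fin n → Fin n} (hc : Good_s6 A c)
    (e : Fin 6 ↪o Fin n) (he : ∀ i, (∃ t, e t = i) ↔ i ∉ A ∧ ¬ ∃ x ∈ A, c x = i)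
    {p : Fin 6 → Fin 6} (hp : p ∈ Pat) {f : Fin n → Fin n} (hf : IsPairing f)
    (g1 : ∀ i ∈ A, f i = c i) (g3 : ∀ t, f (e t) = e (p t)) :
    (∀ i, CrossVert f i ↔ ∃ t, e t = i) ∧ Aof f = A := by
  have g2 : ∀ i ∈ A, f (c i) = i := fun i hi => by rw [← g1 i hi, hf.1]
  have harc : ∀ i ∈ A, ∀ j, CircBtw i (f i) j → CircBtw i (f i) (f j) := by
    intro i hi j ⟨h0, h1⟩
    rw [g1 i hi] at h1 ⊢
    by_cases hj : j ∈ A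
    · have := hc.nest i hi j hj h0 h1
      rw [g1 j hj]
      exact ⟨by omega, this.2⟩
    · obtain ⟨x, hx, h2, h3, rfl⟩ := hc.fill i hi j hj h0 h1
      rw [g2 x hx]
      exact ⟨h2, h3⟩
  have hnA : ∀ i ∈ A, ¬ CrossVert f i := by
    rintro i hi ⟨j, -, -, hx⟩
    rcases hx with ⟨h1, h2⟩ | ⟨h1, h2⟩
    · exact h2 (harc i hi j h1)
    · have := harc i hi _ h1
      rw [hf.1] at this
      exact h2 this
  have hcr : ∀ i, CrossVert f i ↔ ∃ t, e t = i := by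
    intro i
    constructor
    · intro h
      rw [he]
      refine ⟨fun hi => hnA i hi h, ?_⟩
      rintro ⟨x, hx, rfl⟩
      rw [← g1 x hx, crossVert_f hf] at h
      exact hnA x hx h
    · rintro ⟨t, rfl⟩
      rw [crossVert_iff hf]
      obtain ⟨s, hs⟩ := Pat_cross p hp t
      refine ⟨e s, ?_⟩
      rw [g3, g3, Xc_emb]
      exact hs
  have hsub : ∀ i ∈ A, i ∈ Aof f := by
    intro i hi
    rw [mem_Aof]
    refine ⟨hnA i hi, ?_⟩
    rintro s hs ⟨h0, h1⟩
    rw [hcr, he] at hs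
    rw [g1 i hi] at h1
    obtain ⟨x, hx, -, -, h⟩ := hc.fill i hi s hs.1 h0 h1
    exact hs.2 ⟨x, hx, h⟩
  refine ⟨hcr, ?_⟩
  ext i
  refine ⟨fun hi => ?_, hsub i⟩
  by_contra h
  have h1 : ¬ CrossVert f i := (mem_Aof.1 hi).1
  have h2 : ∃ x ∈ A, c x = i := by
    by_contra h2
    exact h1 ((hcr i).2 ((he i).2 ⟨h, h2⟩))
  obtain ⟨x, hx, rfl⟩ := h2
  rw [← g1 x hx] at hi
  exact (Aof_xor hf e hcr (hnA x hx)).1 hi (hsub x hx)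

/-! ### Counting -/

open Classical in
/-- The crossing vertices. -/
noncomputable def crossSet {n : ℕ} (f : Fin n → Fin n) : Finset (Fin n) :=
  Finset.univ.filter (fun i => CrossVert f i)

lemma exists_emb {n : ℕ} (S : Finset (Fin n)) (hS : S.card = 6) :
    ∃ e : Fin 6 ↪o Fin n, ∀ i, (∃ t, e t = i) ↔ i ∈ S := by
  refine ⟨S.orderEmbOfFin hS, fun i => ?_⟩
  have := S.range_orderEmbOfFin hS
  rw [← Finset.mem_coe, ← this]
  rfl

lemma crossSet_emb {n : ℕ} {f : Fin n → Fin n} (h : (crossSet f).card = 6) :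
    ∃ e : Fin 6 ↪o Fin n, ∀ i, CrossVert f i ↔ ∃ t, e t = i := by
  obtain ⟨e, he⟩ := exists_emb _ h
  refine ⟨e, fun i => ?_⟩
  rw [he]
  simp [crossSet]

open Classical in
lemma fiber_card {n : ℕ} (A : Finset (Fin n)) (hA : 2 * A.card + 6 = n) :
    (Finset.univ.filter (fun f : Fin n → Fin n =>
      (IsPairing f ∧ (crossSet f).card = 6) ∧ Aof f = A)).card = 4 := by
  obtain ⟨c, hc⟩ := exists_good_s6 A (by omega)
  have hU : (Finset.univ \ (A ∪ A.image c)).card = 6 := by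
    have hd : Disjoint A (A.image c) := by
      rw [Finset.disjoint_left]
      intro i hi h
      obtain ⟨j, hj, rfl⟩ := mem_image.1 h
      exact hc.notA j hj hi
    rw [card_sdiff_of_subset (subset_univ _), card_union_of_disjoint hd, card_image_of_injOn]
    · simp; omega
    · intro i hi j hj h
      exact hc.inj i hi j hj h
  obtain ⟨e, he'⟩ := exists_emb _ hU
  have he : ∀ i, (∃ t, e t = i) ↔ i ∉ A ∧ ¬ ∃ x ∈ A, c x = i := by
    intro i
    rw [he']
    simp
  have hb : ∀ p : Fin 6 → Fin 6, ∃ f : Fin n → Fin n, p ∈ Pat → IsPairing f ∧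
      (∀ i ∈ A, f i = c i) ∧ ∀ t, f (e t) = e (p t) := by
    intro p
    by_cases hp : p ∈ Pat
    · obtain ⟨f, hf⟩ := build hc e he hp
      exact ⟨f, fun _ => hf⟩
    · exact ⟨id, fun h => absurd h hp⟩
  choose F hF using hb
  rw [← Pat_card]
  symm
  refine Finset.card_bij (fun p _ => F p) ?_ ?_ ?_
  · intro p hp
    obtain ⟨h1, h2, h3⟩ := hF p hp
    obtain ⟨h4, h5⟩ := build_props hc e he hp h1 h2 h3
    simp only [mem_filter, mem_univ, true_and]
    refine ⟨⟨h1, ?_⟩, h5⟩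
    have : crossSet (F p) = Finset.univ.image e := by
      ext i
      simp [crossSet, h4]
    rw [this, card_image_of_injective _ e.injective]
    simp
  · intro p hp q hq hpq
    obtain ⟨h1, h2, h3⟩ := hF p hp
    obtain ⟨k1, k2, k3⟩ := hF q hq
    funext t
    apply e.injective
    rw [← h3, ← k3]
    exact congrFun hpq _
  · intro f hf
    simp only [mem_filter, mem_univ, true_and] at hf
    obtain ⟨⟨h1, h2⟩, h3⟩ := hf
    obtain ⟨e2, h4⟩ := crossSet_emb h2
    have hg := good_Aof h1 e2 h4
    have hx := fun i => @Aof_xor n f h1 e2 h4 i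
    rw [h3] at hg
    have hfc : ∀ i ∈ A, f i = c i := fun i hi => hg.unique hc _ i hi rfl
    have h5 : ∀ i, CrossVert f i ↔ ∃ t, e t = i := by
      intro i
      rw [he]
      constructor
      · intro h
        have : ∀ x ∈ A, ¬ CrossVert f x := by
          intro x hx
          rw [← h3] at hx
          exact (mem_Aof.1 hx).1
        refine ⟨fun hi => this i hi h, ?_⟩
        rintro ⟨x, hx, rfl⟩
        rw [← hfc x hx, crossVert_f h1] at h
        exact this x hx h
      · rintro ⟨h, h'⟩
        by_contra hn
        have := (hx i hn).2 (by rw [h3]; exact h)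
        rw [h3] at this
        exact h' ⟨f i, this, by rw [← hfc _ this, h1.1]⟩
    obtain ⟨p, hp, hpe⟩ := exists_pat h1 e h5
    refine ⟨p, hp, ?_⟩
    obtain ⟨k1, k2, k3⟩ := hF p hp
    funext i
    by_cases hi : i ∈ A
    · rw [k2 i hi, hfc i hi]
    · by_cases h2 : ∃ x ∈ A, c x = i
      · obtain ⟨x, hx, rfl⟩ := h2
        have a1 := k1.1 x
        have a2 := h1.1 x
        rw [k2 x hx] at a1
        rw [hfc x hx] at a2
        rw [a1, a2]
      · obtain ⟨t, rfl⟩ := (he i).2 ⟨hi, h2⟩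
        rw [k3, hpe]

/-- The number of pairings of `2k` vertices with exactly `6` crossing vertices
is `4 * C(2k, k-3)`. -/
theorem Cr_six (k : ℕ) (hk : 3 ≤ k) : Cr k 6 = 4 * Nat.choose (2*k) (k - 3) := by
  classical
  have h1 : Cr k 6 = (Finset.univ.filter (fun f : Fin (2*k) → Fin (2*k) =>
      IsPairing f ∧ (crossSet f).card = 6)).card := by
    unfold Cr pairings crossCount crossSet
    rw [Finset.filter_filter]
  rw [h1, Finset.card_eq_sum_card_fiberwise (f := Aof)
    (t := Finset.powersetCard (k - 3) Finset.univ)]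
  · rw [Finset.sum_congr rfl (g := fun _ => 4)]
    · simp [Finset.card_powersetCard, mul_comm]
    · intro A hA
      rw [Finset.filter_filter]
      have := (Finset.mem_powersetCard.1 hA).2
      exact fiber_card A (by omega)
  · intro f hf
    simp only [coe_filter, mem_univ, true_and, Set.mem_ofPred_eq] at hf
    obtain ⟨e, he⟩ := crossSet_emb hf.2
    have := card_Aof hf.1 e he
    simp only [Finset.mem_coe, Finset.mem_powersetCard]
    exact ⟨subset_univ _, by omega⟩
end

section
/- Among all perfect matchings of 8 vertices on a circle, exactly 31 have the property that all 8 vertices are involved in crossings; equivalently, Cr_{8,8} = 7!! - 4*binomial(8,1) - binomial(8,2) - C_4 = 31. -/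
open Finset

instance decPairing8 {n : ℕ} (f : Fin n → Fin n) : Decidable (IsPairing f) := by
  unfold IsPairing; infer_instance

instance decCrossVert8 {n : ℕ} (f : Fin n → Fin n) (i : Fin n) : Decidable (CrossVert f i) := by
  unfold CrossVert ChordsCross CircBtw Xor'; infer_instance

/-- Compatibility of a new value `a` (at position `l.length`) with a prefix `l`. -/
def okNext (l : List (Fin 8)) (a : Fin 8) : Bool :=
  decide (a.val ≠ l.length) &&
    (List.finRange 8).all (fun j => decide (j.val < l.length →
      ((l.getD j.val 0).val = l.length ↔ a = j)))

/-- Value lists of partial pairings, by length. -/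
def genPref : ℕ → List (List (Fin 8))
  | 0 => [[]]
  | k + 1 => (genPref k).flatMap (fun l =>
      ((List.finRange 8).filter (okNext l)).map (fun a => l ++ [a]))

/-- The function with a given list of values. -/
def toFun8 (l : List (Fin 8)) : Fin 8 → Fin 8 := fun i => l.getD i.val 0

lemma take_mem_genPref (f : Fin 8 → Fin 8) (hf : IsPairing f) :
    ∀ k, k ≤ 8 → (List.ofFn f).take k ∈ genPref k := by
  intro k
  induction k with
  | zero => intro _; simp [genPref]
  | succ k ih =>
    intro hk
    have h := ih (by omega)
    have hlen : ((List.ofFn f).take k).length = k := by simp; omega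
    simp only [genPref, List.mem_flatMap, List.mem_map, List.mem_filter]
    refine ⟨_, h, f ⟨k, by omega⟩, ⟨List.mem_finRange _, ?_⟩, ?_⟩
    · simp only [okNext, hlen, Bool.and_eq_true, decide_eq_true_eq, List.all_eq_true]
      refine ⟨fun e => hf.2 ⟨k, by omega⟩ (Fin.ext e), fun j _ hj => ?_⟩
      have e : ((List.ofFn f).take k).getD j.val 0 = f j := by
        rw [List.getD_eq_getElem _ _ (by rw [hlen]; exact hj)]
        rw [List.getElem_take, List.getElem_ofFn]
      rw [e]
      constructor
      · intro e
        have : f j = ⟨k, by omega⟩ := Fin.ext e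
        rw [← this, hf.1]
      · intro e
        rw [← e, hf.1]
    · rw [List.take_add_one]
      rw [List.getElem?_ofFn, dif_pos (show k < 8 by omega), Option.toList_some]

/-- Explicit list of the value lists of fully crossing pairings. -/
def goodList : List (List (Fin 8)) :=
  (genPref 8).filter (fun l => decide (∀ i, CrossVert (toFun8 l) i))

lemma goodList_spec : ∀ l ∈ goodList, List.ofFn (toFun8 l) = l ∧ IsPairing (toFun8 l) ∧
    ∀ i, CrossVert (toFun8 l) i := by
  decide +kernel

lemma goodList_card : goodList.toFinset.card = 31 := by
  decide +kernel

lemma toFun8_ofFn (f : Fin 8 → Fin 8) : toFun8 (List.ofFn f) = f := by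
  funext i
  unfold toFun8
  rw [List.getD_eq_getElem _ _ (by simp)]
  rw [List.getElem_ofFn]

lemma Cr_four_eight : Cr 4 8 = 31 := by
  classical
  have key : ∀ f : Fin 8 → Fin 8, crossCount 4 f = 8 ↔ ∀ i, CrossVert f i := by
    intro f
    unfold crossCount
    have := Finset.card_filter_eq_iff (s := (Finset.univ : Finset (Fin 8)))
      (p := fun i => CrossVert f i)
    rw [Finset.card_univ, Fintype.card_fin] at this
    simp only [Finset.mem_univ, true_implies] at this
    rw [← this]
    constructor <;> intro h <;> convert h
  rw [← goodList_card]
  unfold Cr pairings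
  refine Finset.card_bij (fun f _ => List.ofFn (n := 8) f) ?_ ?_ ?_
  · intro f hf
    simp only [Finset.mem_filter, Finset.mem_univ, true_and] at hf
    have h2 := (key f).1 hf.2
    have h1 := take_mem_genPref f hf.1 8 le_rfl
    rw [List.take_of_length_le (by simp)] at h1
    rw [List.mem_toFinset, goodList, List.mem_filter, decide_eq_true_eq, toFun8_ofFn]
    exact ⟨h1, h2⟩
  · intro f _ g _ h
    exact List.ofFn_injective h
  · intro l hl
    obtain ⟨h1, h2, h3⟩ := goodList_spec l (List.mem_toFinset.1 hl)
    refine ⟨toFun8 l, ?_, h1⟩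
    simp only [Finset.mem_filter, Finset.mem_univ, true_and]
    exact ⟨h2, (key _).2 h3⟩

/-- Among all pairings of `8` vertices on a circle, exactly `31` have all `8`
vertices involved in crossings; equivalently
`Cr_{8,8} = 7!! - 4*C(8,1) - C(8,2) - C_4 = 31`. -/
theorem Cr_eight_eight :
    Cr 4 8 = 31 ∧
    Cr 4 8 = Nat.doubleFactorial 7 - 4 * Nat.choose 8 1 - Nat.choose 8 2 - catalan 4 := by
  refine ⟨Cr_four_eight, ?_⟩
  rw [Cr_four_eight, catalan_eq_centralBinom_div]
  decide +kernel
end
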